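/- arXiv:2603.06602 — 5 statements merged into one kernel-verified Lean document; each statement's English description precedes it below -/
import Mathlib

section
/- Fix m, n, h ∈ ℕ with, for every coordinate t ∈ Fin m, the denominator ∑_{i=1}^{n} (ν_{a(i)}(t))² strictly positive, where ν : Fin h → (Fin m → ℝ) is a fixed family of protocentroids, X : Fin n → (Fin m → ℝ) is a family of data points, and a : Fin n → Fin h assigns each data point to a protocentroid. Define the objective F(v) = ∑_{i=1}^{n} ∑_{t=1}^{m} (X_i(t) − v(t)·ν_{a(i)}(t))². Then the vector v* defined coordinatewise by v*(t) = (∑_{i=1}^{n} X_i(t)·ν_{a(i)}(t)) / (∑_{i=1}^{n} (ν_{a(i)}(t))²) is the unique global minimizer of F: for every v : Fin m → ℝ one has F(v*) ≤ F(v), with equality only if v = v*. (This is the closed-form protocentroid update of Khatri-Rao k-Means for the product aggregator, Proposition 1.) -/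
/-- The Khatri-Rao k-Means objective (product aggregator) contributed by a single
protocentroid `v` being updated: `F v = ∑ i ∑ t (X i t - v t * ν (a i) t)²`. -/
noncomputable def krObjProd (m n h : ℕ) (ν : Fin h → Fin m → ℝ) (X : Fin n → Fin m → ℝ)
    (a : Fin n → Fin h) (v : Fin m → ℝ) : ℝ :=
  ∑ i : Fin n, ∑ t : Fin m, (X i t - v t * ν (a i) t) ^ 2

/-- The closed-form protocentroid update for the product aggregator. -/
noncomputable def krUpdateProd (m n h : ℕ) (ν : Fin h → Fin m → ℝ) (X : Fin n → Fin m → ℝ)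
    (a : Fin n → Fin h) : Fin m → ℝ :=
  fun t => (∑ i : Fin n, X i t * ν (a i) t) / (∑ i : Fin n, (ν (a i) t) ^ 2)

/-- Completing the square around the one-dimensional least-squares coefficient. -/
theorem sum_sub_mul_sq_eq_add_sq {ι : Type*} (s : Finset ι) (x y : ι → ℝ)
    (hy : ∑ i ∈ s, y i ^ 2 ≠ 0) (c : ℝ) :
    ∑ i ∈ s, (x i - c * y i) ^ 2 =
      ∑ i ∈ s, (x i - (∑ j ∈ s, x j * y j) / (∑ j ∈ s, y j ^ 2) * y i) ^ 2 +
        (∑ i ∈ s, y i ^ 2) * (c - (∑ j ∈ s, x j * y j) / (∑ j ∈ s, y j ^ 2)) ^ 2 := by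
  have expand (b : ℝ) : ∑ i ∈ s, (x i - b * y i) ^ 2 =
      ∑ i ∈ s, x i ^ 2 - 2 * b * ∑ i ∈ s, x i * y i + b ^ 2 * ∑ i ∈ s, y i ^ 2 := by
    rw [Finset.mul_sum, Finset.mul_sum, ← Finset.sum_sub_distrib, ← Finset.sum_add_distrib]
    exact Finset.sum_congr rfl fun i _ => by ring
  rw [expand, expand]
  field_simp
  ring

theorem krObjProd_eq_update_add (m n h : ℕ) (ν : Fin h → Fin m → ℝ)
    (X : Fin n → Fin m → ℝ) (a : Fin n → Fin h)
    (hpos : ∀ t : Fin m, 0 < ∑ i : Fin n, (ν (a i) t) ^ 2) (v : Fin m → ℝ) :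
    krObjProd m n h ν X a v = krObjProd m n h ν X a (krUpdateProd m n h ν X a) +
      ∑ t : Fin m, (∑ i : Fin n, (ν (a i) t) ^ 2) * (v t - krUpdateProd m n h ν X a t) ^ 2 := by
  unfold krObjProd
  rw [Finset.sum_comm, Finset.sum_comm (f := fun i t =>
    (X i t - krUpdateProd m n h ν X a t * ν (a i) t) ^ 2), ← Finset.sum_add_distrib]
  exact Finset.sum_congr rfl fun t _ =>
    sum_sub_mul_sq_eq_add_sq Finset.univ (fun i => X i t) (fun i => ν (a i) t) (hpos t).ne' (v t)

/-- Proposition 1 (product aggregator): the closed-form update is the unique global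
minimizer of the objective. -/
theorem krUpdateProd_is_unique_minimizer (m n h : ℕ) (ν : Fin h → Fin m → ℝ)
    (X : Fin n → Fin m → ℝ) (a : Fin n → Fin h)
    (hpos : ∀ t : Fin m, 0 < ∑ i : Fin n, (ν (a i) t) ^ 2) :
    ∀ v : Fin m → ℝ,
      krObjProd m n h ν X a (krUpdateProd m n h ν X a) ≤ krObjProd m n h ν X a v ∧
      (krObjProd m n h ν X a (krUpdateProd m n h ν X a) = krObjProd m n h ν X a v →
        v = krUpdateProd m n h ν X a) := by
  intro v
  have nonneg : ∀ t ∈ Finset.univ, 0 ≤ (∑ i : Fin n, (ν (a i) t) ^ 2) *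
      (v t - krUpdateProd m n h ν X a t) ^ 2 :=
    fun t _ => mul_nonneg (hpos t).le (sq_nonneg _)
  rw [krObjProd_eq_update_add m n h ν X a hpos v]
  refine ⟨le_add_of_nonneg_right (Finset.sum_nonneg nonneg), fun heq => ?_⟩
  funext t
  have hzero := (Finset.sum_eq_zero_iff_of_nonneg nonneg).mp (left_eq_add.mp heq) t
    (Finset.mem_univ t)
  exact sub_eq_zero.mp (pow_eq_zero_iff two_ne_zero |>.mp
    ((mul_eq_zero.mp hzero).resolve_left (hpos t).ne'))
end

section
/- Fix m, n, h ∈ ℕ, protocentroids ν : Fin h → (Fin m → ℝ), data points X : Fin n → (Fin m → ℝ), and an assignment a : Fin n → Fin h. The function F : (Fin m → ℝ) → ℝ defined by F(v) = ∑_{i=1}^{n} ∑_{t=1}^{m} (X_i(t) − v(t)·ν_{a(i)}(t))² is convex on ℝ^m. Moreover, if for every coordinate t ∈ Fin m the quantity ∑_{i=1}^{n} (ν_{a(i)}(t))² is strictly positive, then F is strictly convex on ℝ^m. -/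
/-- The convexity gap of the quadratic `krObjProd` along a segment, computed exactly. -/
theorem krObjProd_convexity_gap {m n h : ℕ} (ν : Fin h → Fin m → ℝ) (X : Fin n → Fin m → ℝ)
    (a : Fin n → Fin h) (x y : Fin m → ℝ) {p q : ℝ} (hpq : p + q = 1) :
    p • krObjProd m n h ν X a x + q • krObjProd m n h ν X a y =
      krObjProd m n h ν X a (p • x + q • y) +
        p * q * ∑ t : Fin m, (x t - y t) ^ 2 * ∑ i : Fin n, (ν (a i) t) ^ 2 := by
  obtain rfl : q = 1 - p := by linarith
  simp only [krObjProd, Finset.mul_sum, smul_eq_mul, Pi.add_apply, Pi.smul_apply]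
  rw [Finset.sum_comm (s := (Finset.univ : Finset (Fin m)))]
  simp only [← Finset.sum_add_distrib]
  refine Finset.sum_congr rfl fun i _ => Finset.sum_congr rfl fun t _ => ?_
  ring

/-- The objective `F` is convex on all of `ℝ^m`, and strictly convex whenever
`∑ i, (ν (a i) t)² > 0` for every coordinate `t`. -/
theorem krObjProd_convex_and_strictConvex (m n h : ℕ) (ν : Fin h → Fin m → ℝ)
    (X : Fin n → Fin m → ℝ) (a : Fin n → Fin h) :
    ConvexOn ℝ Set.univ (krObjProd m n h ν X a) ∧
    ((∀ t : Fin m, 0 < ∑ i : Fin n, (ν (a i) t) ^ 2) →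
      StrictConvexOn ℝ Set.univ (krObjProd m n h ν X a)) := by
  refine ⟨⟨convex_univ, fun x _ y _ p q hp hq hpq => ?_⟩,
    fun hν => ⟨convex_univ, fun x _ y _ hxy p q hp hq hpq => ?_⟩⟩
  · rw [krObjProd_convexity_gap ν X a x y hpq]
    exact le_add_of_nonneg_right (by positivity)
  · rw [krObjProd_convexity_gap ν X a x y hpq]
    obtain ⟨t, ht⟩ := Function.ne_iff.mp hxy
    refine lt_add_of_pos_right _ (mul_pos (mul_pos hp hq) ?_)
    exact Finset.sum_pos' (fun s _ => by positivity)
      ⟨t, Finset.mem_univ t, mul_pos (sq_pos_of_ne_zero (sub_ne_zero.mpr ht)) (hν t)⟩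
end

section
/- Let b ∈ ℕ with b ≥ 3, and let e = exp(1). For a positive divisor d of b, write V(d) = (b / d : ℝ)^d (a natural power of a rational value, viewed in ℝ). Let d₋ be the largest positive divisor of b with (d₋ : ℝ) ≤ b / e and let d₊ be the smallest positive divisor of b with (d₊ : ℝ) ≥ b / e (both exist, since 1 and b are divisors of b and 1 ≤ b/e ≤ b for b ≥ 3). Then for every positive divisor d of b, V(d) ≤ max(V(d₋), V(d₊)). In particular, any divisor of b maximizing V over the divisors of b is one of the two divisors of b closest to b/e. (Proposition 2 of the paper.) -/
/-- If moving from `x` to `y` goes in the direction of `a / e` without crossing it, then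
`(a / t) ^ t` does not decrease from `t = x` to `t = y`. -/
lemma div_pow_le_div_pow_of_toward_div_exp {a : ℝ} (ha : 0 < a) {x y : ℕ} (hx : 0 < x)
    (hy : 0 < y) (h : 0 ≤ ((y : ℝ) - x) * (Real.log (a / y) - 1)) :
    (a / x) ^ x ≤ (a / y) ^ y := by
  have hx' : (0 : ℝ) < x := by exact_mod_cast hx
  have hy' : (0 : ℝ) < y := by exact_mod_cast hy
  rw [← Real.log_le_log_iff (by positivity) (by positivity), Real.log_pow, Real.log_pow]
  have hsplit : Real.log (a / x) = Real.log (a / y) + Real.log (y / x) := by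
    rw [← Real.log_mul (by positivity) (by positivity)]
    congr 1
    field_simp
  have hlog : x * Real.log (y / x) ≤ y - x := by
    have := mul_le_mul_of_nonneg_left
      (Real.log_le_sub_one_of_pos (show (0 : ℝ) < y / x by positivity)) hx'.le
    rwa [mul_sub, mul_div_cancel₀ _ hx'.ne', mul_one] at this
  rw [hsplit]
  linarith

/-- Proposition 2: given a budget `b ≥ 3` of vectors, among the positive divisors `d` of
`b` (each allowing `b / d` protocentroids per set and hence `(b / d) ^ d` representable
centroids), the count `V d = ((b : ℝ) / d) ^ d` is maximized at one of the two divisors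
closest to `b / e`: `d₋`, the largest divisor with `d₋ ≤ b / e`, or `d₊`, the smallest
divisor with `d₊ ≥ b / e`. -/
theorem divisor_maximizer_near_b_div_e (b : ℕ) (hb : 3 ≤ b) (dminus dplus : ℕ)
    (hdm_dvd : dminus ∣ b) (hdm_pos : 0 < dminus)
    (hdm_le : (dminus : ℝ) ≤ (b : ℝ) / Real.exp 1)
    (hdm_max : ∀ d : ℕ, d ∣ b → 0 < d → (d : ℝ) ≤ (b : ℝ) / Real.exp 1 → d ≤ dminus)
    (hdp_dvd : dplus ∣ b) (hdp_pos : 0 < dplus)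
    (hdp_ge : (b : ℝ) / Real.exp 1 ≤ (dplus : ℝ))
    (hdp_min : ∀ d : ℕ, d ∣ b → 0 < d → (b : ℝ) / Real.exp 1 ≤ (d : ℝ) → dplus ≤ d) :
    ∀ d : ℕ, d ∣ b → 0 < d →
      ((b : ℝ) / d) ^ d ≤
        max (((b : ℝ) / dminus) ^ dminus) (((b : ℝ) / dplus) ^ dplus) := by
  intro d hd hd0
  have hb0 : (0 : ℝ) < b := by
    exact_mod_cast (by omega : 0 < b)
  have hm0 : (0 : ℝ) < dminus := by exact_mod_cast hdm_pos
  have hp0 : (0 : ℝ) < dplus := by exact_mod_cast hdp_pos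
  have he := Real.exp_pos 1
  rcases le_total (d : ℝ) ((b : ℝ) / Real.exp 1) with h | h
  · refine le_max_of_le_left (div_pow_le_div_pow_of_toward_div_exp hb0 hd0 hdm_pos ?_)
    have hle : (d : ℝ) ≤ dminus := by exact_mod_cast hdm_max d hd hd0 h
    have hlog : 1 ≤ Real.log (b / dminus) := by
      rw [Real.le_log_iff_exp_le (by positivity), le_div_iff₀ hm0, mul_comm]
      exact (le_div_iff₀ he).mp hdm_le
    exact mul_nonneg (sub_nonneg.2 hle) (sub_nonneg.2 hlog)
  · refine le_max_of_le_right (div_pow_le_div_pow_of_toward_div_exp hb0 hd0 hdp_pos ?_)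
    have hle : (dplus : ℝ) ≤ d := by exact_mod_cast hdp_min d hd hd0 h
    have hlog : Real.log (b / dplus) ≤ 1 := by
      rw [Real.log_le_iff_le_exp (by positivity), div_le_iff₀ hp0, mul_comm]
      exact (div_le_iff₀ he).mp hdp_ge
    exact mul_nonneg_of_nonpos_of_nonpos (sub_nonpos.2 hle) (sub_nonpos.2 hlog)
end

section
/- Fix m, k, h ∈ ℕ with k ≥ 1 and h ≥ 2, and let M be any finite set of vectors in Fin m → ℝ with card(M) = k. Let p = ⌈k / (h − 1)⌉. Then there exist p sets of protocentroids S : Fin p → Finset (Fin m → ℝ), each with card(S_i) ≤ h, such that every μ ∈ M lies in the Khatri-Rao product aggregation K = { v | ∃ c, (∀ i, c(i) ∈ S_i) ∧ v = (fun t ↦ ∏_{i} c(i)(t)) }. Concretely, each set consists of the all-ones vector together with at most h − 1 of the centroids in M, the centroids being partitioned among the sets, and each centroid is recovered by choosing itself in its own set and the all-ones vector in every other set. (This is the upper-bound half of Proposition 3, for the product aggregator: ⌈k/(h_min − 1)⌉ sets always suffice to represent k centroids.) -/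
/-- A finite set of at most `n * q` elements is covered by `n` subsets of at most `q` elements. -/
theorem Finset.exists_cover_card_le {α : Type*} (M : Finset α) {n q : ℕ} (hM : M.card ≤ n * q) :
    ∃ P : Fin n → Finset α,
      (∀ i, P i ⊆ M) ∧ (∀ i, (P i).card ≤ q) ∧ ∀ x ∈ M, ∃ i, x ∈ P i := by
  classical
  let e := M.equivFin
  have hlt (x : M) : (e x : ℕ) / q < n :=
    Nat.div_lt_of_lt_mul (by rw [mul_comm]; exact (e x).isLt.trans_le hM)
  refine ⟨fun i => (Finset.univ.filter fun x : M => (e x : ℕ) / q = i).map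
    (Function.Embedding.subtype _), fun i x hx => ?_, fun i => ?_, fun x hx => ?_⟩
  · obtain ⟨y, -, rfl⟩ := Finset.mem_map.mp hx
    exact y.2
  · rw [Finset.card_map]
    refine (Finset.card_le_card_of_injOn (t := Finset.range q) (fun x => (e x : ℕ) % q)
      (fun x _ => ?_) fun x hx y hy hxy => ?_).trans_eq (Finset.card_range q)
    · have hq : 0 < q := by
        rcases Nat.eq_zero_or_pos q with rfl | hq
        · exact absurd ((e x).isLt.trans_le hM) (by simp)
        · exact hq
      simpa using Nat.mod_lt _ hq
    · simp only [Finset.coe_filter, Finset.mem_univ, true_and, Set.mem_ofPred_eq] at hx hy hxy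
      apply e.injective
      apply Fin.ext
      rw [← Nat.div_add_mod (e x : ℕ) q, ← Nat.div_add_mod (e y : ℕ) q, hx, hy, hxy]
  · exact ⟨⟨_, hlt ⟨x, hx⟩⟩, Finset.mem_map.mpr ⟨⟨x, hx⟩, by simp, rfl⟩⟩

/-- Upper-bound half of Proposition 3 (product aggregator): for any `k ≥ 1` centroids and
`h ≥ 2`, `p = ⌈k / (h - 1)⌉` sets of at most `h` protocentroids each—each set consisting
of the all-ones vector together with at most `h - 1` of the centroids, the centroids
being partitioned among the sets—suffice to represent every centroid via the Khatri-Rao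
product aggregation (each centroid is recovered by choosing itself in its own set and
the all-ones vector in every other set). -/
theorem khatriRao_ceil_sets_suffice_prod (m k h : ℕ) (hk : 1 ≤ k) (hh : 2 ≤ h)
    (M : Finset (Fin m → ℝ)) (hM : M.card = k) :
    ∃ S : Fin ⌈(k : ℝ) / ((h : ℝ) - 1)⌉₊ → Finset (Fin m → ℝ),
      (∀ i, (S i).card ≤ h) ∧
      (∀ i, S i ⊆ insert (fun _ : Fin m => (1 : ℝ)) M) ∧
      ∀ μ ∈ M, ∃ c : Fin ⌈(k : ℝ) / ((h : ℝ) - 1)⌉₊ → (Fin m → ℝ),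
        (∀ i, c i ∈ S i) ∧ μ = fun t : Fin m => ∏ i, c i t := by
  classical
  have hcard : M.card ≤ ⌈(k : ℝ) / ((h : ℝ) - 1)⌉₊ * (h - 1) := by
    have hpos : (0 : ℝ) < (h : ℝ) - 1 := by
      have : (2 : ℝ) ≤ h := by exact_mod_cast hh
      linarith
    have hle := (div_le_iff₀ hpos).mp (Nat.le_ceil ((k : ℝ) / ((h : ℝ) - 1)))
    rw [hM, ← Nat.cast_le (α := ℝ), Nat.cast_mul, Nat.cast_sub (by omega), Nat.cast_one]
    exact hle
  obtain ⟨P, hPM, hPq, hcover⟩ := M.exists_cover_card_le hcard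
  refine ⟨fun i => insert (fun _ => 1) (P i), fun i => ?_,
    fun i => Finset.insert_subset_insert _ (hPM i), fun μ hμ => ?_⟩
  · refine (Finset.card_insert_le _ _).trans ?_
    have hi := hPq i
    omega
  · obtain ⟨j, hj⟩ := hcover μ hμ
    refine ⟨Pi.mulSingle j μ, fun i => ?_, ?_⟩
    · rcases eq_or_ne i j with rfl | hij
      · simpa using Or.inr hj
      · rw [Pi.mulSingle_eq_of_ne hij]
        exact Finset.mem_insert_self _ _
    · funext t
      rw [← Finset.prod_apply, Finset.prod_pi_mulSingle']
      simp
end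

section
/- Fix m, k, h ∈ ℕ with k ≥ 1 and h ≥ 2, and let M be any finite set of vectors in Fin m → ℝ with card(M) = k. Let p = ⌈k / (h − 1)⌉. Then there exist p sets of protocentroids S : Fin p → Finset (Fin m → ℝ), each with card(S_i) ≤ h, such that every μ ∈ M lies in the Khatri-Rao sum aggregation K = { v | ∃ c, (∀ i, c(i) ∈ S_i) ∧ v = (fun t ↦ ∑_{i} c(i)(t)) }. Concretely, each set consists of the zero vector together with at most h − 1 of the centroids in M, the centroids being partitioned among the sets, and each centroid is recovered by choosing itself in its own set and the zero vector in every other set. (This is the upper-bound half of Proposition 3, for the sum aggregator.) -/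
/-- A type with at most `p * q` elements can be distributed over `p` classes of size at most `q`. -/
theorem exists_map_fin_card_fiber_le {α : Type*} [Fintype α] {p q : ℕ}
    (hcard : Fintype.card α ≤ p * q) :
    ∃ f : α → Fin p, ∀ i, (Finset.univ.filter fun x => f x = i).card ≤ q := by
  obtain ⟨g⟩ : Nonempty (α ↪ Fin p × Fin q) :=
    Function.Embedding.nonempty_of_card_le (by simpa using hcard)
  refine ⟨fun x => (g x).1, fun i => ?_⟩
  have hle := Finset.card_le_card_of_injOn (s := Finset.univ.filter fun x => (g x).1 = i)
    (t := (Finset.univ : Finset (Fin q))) (fun x => (g x).2) (fun _ _ => by simp) (by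
      intro x hx y hy hxy
      simp only [Finset.coe_filter, Finset.mem_univ, true_and, Set.mem_ofPred_eq] at hx hy
      exact g.injective (Prod.ext (hx.trans hy.symm) hxy))
  simpa using hle

/-- Adjoining zero to each class of a finite set distributed over `p` classes of size at most `q`
gives `p` sets whose sums represent every element of the finite set. -/
theorem exists_finsets_card_le_sum_eq {V : Type*} [AddCommMonoid V] [DecidableEq V] {p q : ℕ}
    (M : Finset V) (hcard : M.card ≤ p * q) :
    ∃ S : Fin p → Finset V, (∀ i, (S i).card ≤ q + 1) ∧ (∀ i, S i ⊆ insert 0 M) ∧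
      ∀ v ∈ M, ∃ c : Fin p → V, (∀ i, c i ∈ S i) ∧ v = ∑ i, c i := by
  obtain ⟨f, hf⟩ := exists_map_fin_card_fiber_le (α := M) (p := p) (q := q) (by simpa using hcard)
  refine ⟨fun i => insert 0 ((Finset.univ.filter fun x => f x = i).map
    (Function.Embedding.subtype _)), fun i => ?_, fun i => ?_, fun v hv => ?_⟩
  · exact (Finset.card_insert_le _ _).trans (by simpa using hf i)
  · refine Finset.insert_subset_insert _ fun x hx => ?_
    obtain ⟨y, -, rfl⟩ := Finset.mem_map.mp hx
    exact y.2
  · refine ⟨Pi.single (f ⟨v, hv⟩) v, fun i => ?_, by simp⟩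
    by_cases hi : i = f ⟨v, hv⟩
    · subst hi
      rw [Pi.single_eq_same]
      exact Finset.mem_insert_of_mem (Finset.mem_map.mpr ⟨⟨v, hv⟩, by simp, rfl⟩)
    · rw [Pi.single_eq_of_ne hi]
      exact Finset.mem_insert_self _ _

/-- Upper-bound half of Proposition 3 (sum aggregator): for any `k ≥ 1` centroids and
`h ≥ 2`, `p = ⌈k / (h - 1)⌉` sets of at most `h` protocentroids each—each set consisting
of the zero vector together with at most `h - 1` of the centroids, the centroids being
partitioned among the sets—suffice to represent every centroid via the Khatri-Rao sum
aggregation (each centroid is recovered by choosing itself in its own set and the zero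
vector in every other set). -/
theorem khatriRao_ceil_sets_suffice_sum (m k h : ℕ) (hk : 1 ≤ k) (hh : 2 ≤ h)
    (M : Finset (Fin m → ℝ)) (hM : M.card = k) :
    ∃ S : Fin ⌈(k : ℝ) / ((h : ℝ) - 1)⌉₊ → Finset (Fin m → ℝ),
      (∀ i, (S i).card ≤ h) ∧
      (∀ i, S i ⊆ insert (fun _ : Fin m => (0 : ℝ)) M) ∧
      ∀ μ ∈ M, ∃ c : Fin ⌈(k : ℝ) / ((h : ℝ) - 1)⌉₊ → (Fin m → ℝ),
        (∀ i, c i ∈ S i) ∧ μ = fun t : Fin m => ∑ i, c i t := by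
  have hpos : (0 : ℝ) < (h : ℝ) - 1 := by
    have : (2 : ℝ) ≤ h := by exact_mod_cast hh
    linarith
  have hcard : M.card ≤ ⌈(k : ℝ) / ((h : ℝ) - 1)⌉₊ * (h - 1) := by
    have hle := (div_le_iff₀ hpos).mp (Nat.le_ceil ((k : ℝ) / ((h : ℝ) - 1)))
    rw [hM]
    have hcast : ((h - 1 : ℕ) : ℝ) = (h : ℝ) - 1 := by
      rw [Nat.cast_sub (by omega), Nat.cast_one]
    rw [← hcast] at hle ⊢
    exact_mod_cast hle
  obtain ⟨S, hS, hsub, hsum⟩ := exists_finsets_card_le_sum_eq M hcard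
  refine ⟨S, fun i => (hS i).trans (by omega), hsub, fun μ hμ => ?_⟩
  obtain ⟨c, hc, hc_sum⟩ := hsum μ hμ
  exact ⟨c, hc, hc_sum.trans (funext fun t => Finset.sum_apply t _ _)⟩
end
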